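/- arXiv:2408.07517 — 4 statements merged into one kernel-verified Lean document; each statement's English description precedes it below -/
import Mathlib

section
/- Let τ_u > 0, τ_w > 0 be real numbers and let a ≥ -1 be real. Consider the 2×2 real matrix A = [[-1/τ_u, -1/τ_u], [a/τ_w, -1/τ_w]]. Then every complex root λ of the characteristic polynomial of A satisfies Re(λ) ≤ 0 (i.e., the continuous-time adLIF system is Lyapunov stable). -/
open Matrix Polynomial

/-- `lam` is a complex eigenvalue of the real matrix `A`, i.e. a root of the
characteristic polynomial of `A` over `ℂ`. -/
def isEigenvalue (A : Matrix (Fin 2) (Fin 2) ℝ) (lam : ℂ) : Prop :=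
  ((A.map (fun x : ℝ => (x : ℂ))).charpoly).IsRoot lam

/-- The continuous-time adLIF state matrix. -/
noncomputable def adLIFmat (τu τw a : ℝ) : Matrix (Fin 2) (Fin 2) ℝ :=
  !![-1/τu, -1/τu; a/τw, -1/τw]

/-- The continuous-time adLIF neuron is Lyapunov stable for `a ≥ -1`:
every complex eigenvalue of its state matrix has nonpositive real part. -/
theorem adLIF_continuous_lyapunov_stable (τu τw a : ℝ)
    (hτu : 0 < τu) (hτw : 0 < τw) (ha : -1 ≤ a) :
    ∀ lam : ℂ, isEigenvalue (adLIFmat τu τw a) lam → lam.re ≤ 0 := by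
  intro lam h
  unfold isEigenvalue adLIFmat at h
  have hp : 0 < τu⁻¹ := inv_pos.mpr hτu
  have hq : 0 < τw⁻¹ := inv_pos.mpr hτw
  rw [Matrix.charpoly_fin_two, Polynomial.IsRoot.def] at h
  simp only [Matrix.trace_fin_two, Matrix.det_fin_two, Matrix.map_apply, Matrix.of_apply,
    Matrix.cons_val', Matrix.cons_val_zero, Matrix.cons_val_one, Matrix.cons_val_fin_one,
    div_eq_mul_inv, Polynomial.eval_add, Polynomial.eval_sub, Polynomial.eval_mul,
    Polynomial.eval_pow, Polynomial.eval_X, Polynomial.eval_C,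
    ← Complex.ofReal_mul, ← Complex.ofReal_add, ← Complex.ofReal_sub] at h
  generalize τu⁻¹ = p at *
  generalize τw⁻¹ = q at *
  have hre := congrArg Complex.re h
  have him := congrArg Complex.im h
  simp only [pow_two, Complex.add_re, Complex.sub_re, Complex.mul_re, Complex.ofReal_re,
    Complex.ofReal_im, Complex.zero_re] at hre
  simp only [pow_two, Complex.add_im, Complex.sub_im, Complex.mul_im, Complex.ofReal_re,
    Complex.ofReal_im, Complex.zero_im] at him
  by_contra! hx
  have hy : lam.im * (2 * lam.re + p + q) = 0 := by linarith
  have hy0 : lam.im = 0 := by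
    rcases mul_eq_zero.mp hy with h0 | h0
    · exact h0
    · linarith
  rw [hy0] at hre
  have h1 : 0 ≤ p * q * (1 + a) := mul_nonneg (mul_pos hp hq).le (by linarith)
  have h2 : 0 < (p + q) * lam.re := mul_pos (by linarith) hx
  have h3 : 0 < lam.re * lam.re := mul_pos hx hx
  nlinarith
end

section
/- Let α, β ∈ (0,1) and a ∈ ℝ. The characteristic polynomial of the Symplectic-Euler adLIF matrix A_SE = [[α, -(1-α)], [aα(1-β), β − a(1−α)(1−β)]] has non-real complex roots if and only if a₁ < a < a₂, where a₁ = (√β − √α)²/((1−α)(1−β)) and a₂ = (√β + √α)²/((1−α)(1−β)). -/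
open Matrix Polynomial

/-- The Symplectic-Euler adLIF state transition matrix. -/
def ASE (α β a : ℝ) : Matrix (Fin 2) (Fin 2) ℝ :=
  !![α, -(1-α); a*α*(1-β), β - a*(1-α)*(1-β)]

lemma ASE_eig_iff (α β a : ℝ) (z : ℂ) : isEigenvalue (ASE α β a) z ↔
    (z.re^2 - z.im^2 + ((1-α)*(1-β)*a - α - β) * z.re + α*β = 0 ∧
      2 * z.re * z.im + ((1-α)*(1-β)*a - α - β) * z.im = 0) := by
  have h : isEigenvalue (ASE α β a) z ↔
      z^2 + (((1-α)*(1-β)*a - α - β : ℝ) : ℂ) * z + ((α*β : ℝ) : ℂ) = 0 := by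
    unfold isEigenvalue ASE
    rw [Matrix.charpoly_fin_two, Polynomial.IsRoot.def]
    simp only [Matrix.trace_fin_two, Matrix.det_fin_two, Matrix.map_apply, Matrix.of_apply,
      Matrix.cons_val', Matrix.cons_val_zero, Matrix.cons_val_one, Matrix.cons_val_fin_one,
      Polynomial.eval_add, Polynomial.eval_sub, Polynomial.eval_mul, Polynomial.eval_pow,
      Polynomial.eval_X, Polynomial.eval_C]
    push_cast
    constructor <;> intro h <;> linear_combination h
  rw [h, Complex.ext_iff]
  simp only [pow_two, Complex.add_re, Complex.add_im, Complex.mul_re, Complex.mul_im,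
    Complex.ofReal_re, Complex.ofReal_im, Complex.zero_re, Complex.zero_im]
  constructor <;> rintro ⟨h1, h2⟩ <;> constructor <;> linarith

/-- The characteristic polynomial of the Symplectic-Euler adLIF matrix has non-real
complex roots iff `a₁^SE < a < a₂^SE`, where
`a₁^SE = (√β − √α)²/((1−α)(1−β))` and `a₂^SE = (√β + √α)²/((1−α)(1−β))`. -/
theorem ASE_complex_eigenvalues_iff (α β a : ℝ)
    (hα : α ∈ Set.Ioo (0:ℝ) 1) (hβ : β ∈ Set.Ioo (0:ℝ) 1) :
    (∃ lam : ℂ, isEigenvalue (ASE α β a) lam ∧ lam.im ≠ 0) ↔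
      ((Real.sqrt β - Real.sqrt α)^2 / ((1-α)*(1-β)) < a ∧
        a < (Real.sqrt β + Real.sqrt α)^2 / ((1-α)*(1-β))) := by
  obtain ⟨hα0, hα1⟩ := hα
  obtain ⟨hβ0, hβ1⟩ := hβ
  have hk : 0 < (1-α)*(1-β) := mul_pos (by linarith) (by linarith)
  rw [div_lt_iff₀ hk, lt_div_iff₀ hk]
  have hs := Real.sq_sqrt hα0.le
  have ht := Real.sq_sqrt hβ0.le
  have hst : 0 < √α * √β := mul_pos (Real.sqrt_pos.2 hα0) (Real.sqrt_pos.2 hβ0)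
  have hp : (√α * √β)^2 = α * β := by rw [mul_pow, hs, ht]
  simp only [ASE_eig_iff]
  generalize hT : (1-α)*(1-β)*a - α - β = T
  have key : ((√β - √α)^2 < a * ((1-α)*(1-β)) ∧ a * ((1-α)*(1-β)) < (√β + √α)^2) ↔
      T^2 < (2 * (√α * √β))^2 := by
    rw [sq_lt_sq, abs_of_pos (by linarith : 0 < 2 * (√α * √β)), abs_lt]
    constructor <;> rintro ⟨h1, h2⟩ <;> constructor <;> nlinarith
  rw [key, mul_pow, hp]
  constructor
  · rintro ⟨z, ⟨h1, h2⟩, hz⟩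
    have h3 : T = -2 * z.re := by
      apply mul_right_cancel₀ hz
      linarith
    have h4 : 0 < z.im^2 := by positivity
    subst h3
    nlinarith
  · intro h
    have hd : 0 < α*β - T^2/4 := by linarith
    refine ⟨⟨-T/2, √(α*β - T^2/4)⟩, ⟨?_, ?_⟩, (Real.sqrt_pos.2 hd).ne'⟩
    · simp only [Real.sq_sqrt hd.le]
      ring
    · simp only
      ring
end

section
/- Let α, β ∈ (0,1). For a = a₁^SE = (√β − √α)²/((1−α)(1−β)), the matrix A_SE = [[α, -(1-α)], [aα(1-β), β − a(1−α)(1−β)]] has the single repeated real eigenvalue √(αβ), and for a = a₂^SE = (√β + √α)²/((1−α)(1−β)) it has the single repeated real eigenvalue −√(αβ); in both cases the spectral radius equals √(αβ) < 1. -/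
open Matrix Polynomial

theorem ASE_charpoly_aux (α β a s : ℝ) (h1 : α + β - a*(1-α)*(1-β) = 2*s)
    (h2 : α*β = s^2) : (ASE α β a).charpoly = (X - C s)^2 := by
  rw [Matrix.charpoly_fin_two]
  have ht : (ASE α β a).trace = 2*s := by
    rw [Matrix.trace_fin_two, ← h1]
    simp [ASE]
    ring
  have hd : (ASE α β a).det = s^2 := by
    rw [Matrix.det_fin_two, ← h2]
    simp [ASE]
    ring
  rw [ht, hd]
  simp only [map_mul, map_pow, map_ofNat]
  ring

/-- At `a = a₁^SE` the Symplectic-Euler adLIF matrix has the single repeated real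
eigenvalue `√(αβ)`, and at `a = a₂^SE` the single repeated real eigenvalue `−√(αβ)`;
in both cases the spectral radius equals `√(αβ) < 1`. -/
theorem ASE_repeated_real_eigenvalues (α β : ℝ)
    (hα : α ∈ Set.Ioo (0:ℝ) 1) (hβ : β ∈ Set.Ioo (0:ℝ) 1) :
    (ASE α β ((Real.sqrt β - Real.sqrt α)^2 / ((1-α)*(1-β)))).charpoly
      = (X - C (Real.sqrt (α*β)))^2 ∧
    (ASE α β ((Real.sqrt β + Real.sqrt α)^2 / ((1-α)*(1-β)))).charpoly
      = (X - C (-Real.sqrt (α*β)))^2 ∧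
    Real.sqrt (α*β) < 1 := by
  obtain ⟨ha0, ha1⟩ := hα
  obtain ⟨hb0, hb1⟩ := hβ
  have hne : (1-α)*(1-β) ≠ 0 :=
    mul_ne_zero (by linarith) (by linarith)
  have hs : Real.sqrt (α*β) = Real.sqrt α * Real.sqrt β := Real.sqrt_mul ha0.le β
  have hsa := Real.sq_sqrt ha0.le
  have hsb := Real.sq_sqrt hb0.le
  have hsq := Real.sq_sqrt (mul_pos ha0 hb0).le
  refine ⟨ASE_charpoly_aux _ _ _ _ ?_ ?_, ASE_charpoly_aux _ _ _ _ ?_ ?_, ?_⟩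
  · rw [mul_assoc, div_mul_cancel₀ _ hne, hs]
    linear_combination -hsa - hsb
  · exact hsq.symm
  · rw [mul_assoc, div_mul_cancel₀ _ hne, hs]
    linear_combination -hsa - hsb
  · rw [neg_sq]
    exact hsq.symm
  · rw [Real.sqrt_lt' one_pos]
    nlinarith
end

section
/- Let α, β ∈ (0,1) and let a ∈ ℝ satisfy (α − β)²/(4(1−α)(1−β)) < a < (1 − αβ)/((1−α)(1−β)). Then the eigenvalue λ₁ of A_EF = [[α, -(1-α)], [a(1-β), β]] with positive imaginary part has argument arg(λ₁) ∈ (0, π/2); in particular the intrinsic oscillation frequency f = arg(λ₁)/(2πΔt) of the stable Euler-Forward adLIF neuron is strictly less than half the Nyquist frequency f_N = 1/(2Δt). -/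
open Matrix Polynomial

/-- The Euler-Forward adLIF state transition matrix. -/
def AEF (α β a : ℝ) : Matrix (Fin 2) (Fin 2) ℝ :=
  !![α, -(1-α); a*(1-β), β]

/-- The characteristic equation, in real and imaginary parts. -/
theorem isEigenvalue_AEF_iff (α β a : ℝ) (lam : ℂ) :
    isEigenvalue (AEF α β a) lam ↔
      (lam.re - α) * (lam.re - β) - lam.im ^ 2 + a * (1 - α) * (1 - β) = 0 ∧
      lam.im * (2 * lam.re - α - β) = 0 := by
  have h : isEigenvalue (AEF α β a) lam ↔
      (lam - α) * (lam - β) + a * (1 - α) * (1 - β) = 0 := by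
    unfold isEigenvalue AEF
    rw [Polynomial.IsRoot.def, Matrix.charpoly_fin_two]
    simp [Matrix.trace_fin_two, Matrix.det_fin_two]
    constructor <;> intro h <;> linear_combination h
  rw [h, Complex.ext_iff]
  simp
  constructor <;> rintro ⟨h1, h2⟩ <;> constructor
  · linear_combination h1
  · by_cases h0 : lam.im = 0
    · exact Or.inl h0
    · right
      apply mul_left_cancel₀ h0
      linear_combination h2
  · linear_combination h1
  · rcases h2 with h2 | h2
    · rw [h2]; ring
    · linear_combination lam.im * h2

/-- In the stable oscillatory regime `a₀^EF < a < a_max^EF`, the eigenvalue of the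
Euler-Forward adLIF matrix with positive imaginary part has argument in `(0, π/2)`;
in particular the intrinsic frequency `f = arg(λ₁)/(2πΔt)` is strictly less than half
the Nyquist frequency `f_N = 1/(2Δt)`. -/
theorem AEF_frequency_below_half_nyquist (α β a : ℝ)
    (hα : α ∈ Set.Ioo (0:ℝ) 1) (hβ : β ∈ Set.Ioo (0:ℝ) 1)
    (ha1 : (α - β)^2 / (4*(1-α)*(1-β)) < a)
    (ha2 : a < (1 - α*β) / ((1-α)*(1-β))) :
    (∃ lam : ℂ, isEigenvalue (AEF α β a) lam ∧ 0 < lam.im) ∧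
    (∀ lam : ℂ, isEigenvalue (AEF α β a) lam → 0 < lam.im →
      0 < Complex.arg lam ∧ Complex.arg lam < Real.pi / 2 ∧
      ∀ Δt : ℝ, 0 < Δt →
        Complex.arg lam / (2*Real.pi*Δt) < (1/(2*Δt)) / 2) := by
  obtain ⟨hα0, hα1⟩ := hα
  obtain ⟨hβ0, hβ1⟩ := hβ
  have hp : 0 < 4 * (1 - α) * (1 - β) := by
    have := mul_pos (sub_pos.2 hα1) (sub_pos.2 hβ1)
    linarith
  rw [div_lt_iff₀ hp] at ha1
  constructor
  · have hD : 0 < a * (1 - α) * (1 - β) - ((α - β) / 2) ^ 2 := by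
      linarith
    refine ⟨⟨(α + β) / 2, √(a * (1 - α) * (1 - β) - ((α - β) / 2) ^ 2)⟩, ?_, Real.sqrt_pos.2 hD⟩
    rw [isEigenvalue_AEF_iff]
    refine ⟨?_, ?_⟩
    · simp only [Real.sq_sqrt hD.le]
      ring
    · simp only
      ring
  · intro lam hl him
    rw [isEigenvalue_AEF_iff] at hl
    have hre : 0 < lam.re := by
      have := (mul_eq_zero.1 hl.2).resolve_left him.ne'
      linarith
    have h1 : 0 < Complex.arg lam := by
      refine lt_of_le_of_ne (Complex.arg_nonneg_iff.2 him.le) fun h => ?_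
      exact him.ne' (Complex.arg_eq_zero_iff.1 h.symm).2
    have h2 : Complex.arg lam < Real.pi / 2 :=
      Complex.arg_lt_pi_div_two_iff.2 (Or.inl hre)
    refine ⟨h1, h2, fun Δt ht => ?_⟩
    have hpi := Real.pi_pos
    rw [div_lt_iff₀ (by positivity)]
    have : 1 / (2 * Δt) / 2 * (2 * Real.pi * Δt) = Real.pi / 2 := by
      field_simp
    rw [this]
    exact h2
end
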